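/- Assume t > 2, g₁ is odd, t₁ is even, gcd(d₁, t₁) = 1, gcd(n₁, 2t₁) = 1, and there exists an integer x with n₁x² + d₁ ≡ 0 (mod 2t₁). Then N(n,d,t) = w₊(t₁)·φ(w₋(t₁))·2^{ρ(t₁/2)}. -/

import Mathlib

/-- `wplus w t₁` is the largest divisor of `w` all of whose prime factors divide `t₁`:
the product of the prime powers `p ^ (v_p w)` over primes `p` dividing `gcd(w, t₁)`. -/
def wplus (w t₁ : ℕ) : ℕ :=
  ∏ p ∈ w.primeFactors ∩ t₁.primeFactors, p ^ (w.factorization p)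

/-- `wminus w t₁ = w / wplus w t₁`. -/
def wminus (w t₁ : ℕ) : ℕ := w / wplus w t₁

/-- The only idempotents of `ℤ/p^k` are `0` and `1`. -/
theorem ZMod.isIdempotentElem_prime_pow_iff {p k : ℕ} (hp : p.Prime) (z : ZMod (p ^ k)) :
    IsIdempotentElem z ↔ z = 0 ∨ z = 1 := by
  refine ⟨fun h => ?_, ?_⟩
  · obtain ⟨a, rfl⟩ := ZMod.intCast_surjective z
    have hdvd : ((p : ℤ) ^ k) ∣ a * (a - 1) := by
      have h0 : ((a * (a - 1) : ℤ) : ZMod (p ^ k)) = 0 := by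
        push_cast
        rw [mul_sub, mul_one, sub_eq_zero]
        exact h
      simpa using (ZMod.intCast_zmod_eq_zero_iff_dvd _ _).1 h0
    have hprime : Prime (p : ℤ) := Nat.prime_iff_prime_int.1 hp
    by_cases hpa : (p : ℤ) ∣ a
    · have hpa' : ¬ (p : ℤ) ∣ a - 1 := fun h' => hprime.not_dvd_one (by
        simpa using dvd_sub hpa h')
      left
      have := hprime.pow_dvd_of_dvd_mul_right k hpa' hdvd
      exact (ZMod.intCast_zmod_eq_zero_iff_dvd _ _).2 (by exact_mod_cast this)
    · right
      have := hprime.pow_dvd_of_dvd_mul_left k hpa hdvd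
      have h0 := (ZMod.intCast_zmod_eq_zero_iff_dvd (a - 1) (p ^ k)).2 (by exact_mod_cast this)
      push_cast at h0
      exact sub_eq_zero.1 h0
  · rintro (rfl | rfl)
    exacts [IsIdempotentElem.zero, IsIdempotentElem.one]

/-- `ℤ/s` has `2 ^ ρ(s)` idempotents. -/
theorem ZMod.card_isIdempotentElem {s : ℕ} (hs : s ≠ 0) :
    Nat.card {z : ZMod s // IsIdempotentElem z} = 2 ^ s.primeFactors.card := by
  induction s using Nat.recOnPosPrimePosCoprime with
  | zero => exact absurd rfl hs
  | one =>
    have : Unique {z : ZMod 1 // IsIdempotentElem z} :=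
      { default := ⟨0, IsIdempotentElem.zero⟩, uniq := fun z => Subtype.ext (Subsingleton.elim _ _) }
    rw [Nat.card_unique, Nat.primeFactors_one, Finset.card_empty, pow_zero]
  | prime_pow p k hp hk =>
    have : Fact (1 < p ^ k) := ⟨Nat.one_lt_pow hk.ne' hp.one_lt⟩
    have hset : {z : ZMod (p ^ k) | IsIdempotentElem z} = {0, 1} := by
      ext z
      simp [ZMod.isIdempotentElem_prime_pow_iff hp z]
    rw [Nat.primeFactors_prime_pow hk.ne' hp, Finset.card_singleton, pow_one]
    change Nat.card ({z : ZMod (p ^ k) | IsIdempotentElem z} : Set _) = 2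
    rw [hset, Nat.card_coe_set_eq, Set.ncard_pair zero_ne_one]
  | coprime a b ha hb hab iha ihb =>
    rw [hab.primeFactors_mul, Finset.card_union_of_disjoint hab.disjoint_primeFactors, pow_add,
      ← iha (by lia), ← ihb (by lia), ← Nat.card_prod]
    have e := ZMod.chineseRemainder hab
    refine Nat.card_congr ((e.toEquiv.subtypeEquiv (q := fun z : ZMod a × ZMod b =>
      IsIdempotentElem z.1 ∧ IsIdempotentElem z.2) fun z => ?_).trans
      (Equiv.subtypeProdEquivProd))
    have : IsIdempotentElem z ↔ IsIdempotentElem (e z) := by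
      simp only [IsIdempotentElem, ← map_mul, e.injective.eq_iff]
    rw [this]
    simp [IsIdempotentElem, Prod.ext_iff]

/-- Preimages under reduction of units: every unit modulo `a` has `φ(b) / φ(a)` lifts. -/
theorem ZMod.card_preimage_unitsMap {a b : ℕ} [NeZero a] [NeZero b] (h : a ∣ b)
    (A : Finset (ZMod a)ˣ) :
    (Finset.univ.filter fun u : (ZMod b)ˣ => ZMod.unitsMap h u ∈ A).card * a.totient =
      A.card * b.totient := by
  classical
  have hfib : ∀ v : (ZMod a)ˣ, (Finset.univ.filter fun u => ZMod.unitsMap h u = v).card =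
      (Finset.univ.filter fun u => ZMod.unitsMap h u = 1).card := fun v =>
    MonoidHom.card_fiber_eq_of_mem_range _ (ZMod.unitsMap_surjective h v)
      (ZMod.unitsMap_surjective h 1)
  have hpre : ∀ B : Finset (ZMod a)ˣ,
      (Finset.univ.filter fun u : (ZMod b)ˣ => ZMod.unitsMap h u ∈ B).card =
        B.card * (Finset.univ.filter fun u => ZMod.unitsMap h u = 1).card := fun B => by
    rw [Finset.card_eq_sum_card_fiberwise (f := ZMod.unitsMap h) (t := B)
      (fun u hu => by simpa using hu), ← smul_eq_mul, ← Finset.sum_const]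
    refine Finset.sum_congr rfl fun v hv => ?_
    rw [← hfib v, Finset.filter_filter]
    congr 1
    ext u
    simp only [Finset.mem_filter, Finset.mem_univ, true_and, and_iff_right_iff_imp]
    rintro rfl
    exact hv
  have htot := hpre Finset.univ
  simp only [Finset.mem_univ, Finset.filter_true, Finset.card_univ, ZMod.card_units_eq_totient]
    at htot
  rw [hpre, htot]
  ring

theorem Nat.totient_mul_of_primeFactors_subset {a b : ℕ} (hb : b ≠ 0)
    (h : a.primeFactors ⊆ b.primeFactors) : (a * b).totient = a * b.totient := by
  rcases eq_or_ne a 0 with rfl | ha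
  · simp
  have hpf : (a * b).primeFactors = b.primeFactors := by
    rw [Nat.primeFactors_mul ha hb, Finset.union_eq_right.2 h]
  have h1 := Nat.totient_mul_prod_primeFactors (a * b)
  have h2 := Nat.totient_mul_prod_primeFactors b
  have hpos : 0 < ∏ p ∈ b.primeFactors, p :=
    Finset.prod_pos fun p hp => (Nat.prime_of_mem_primeFactors hp).pos
  rw [hpf, mul_assoc, ← h2, ← mul_assoc] at h1
  exact Nat.eq_of_mul_eq_mul_right hpos h1

theorem wplus_ne_zero (w m : ℕ) : wplus w m ≠ 0 :=
  Finset.prod_ne_zero_iff.2 fun _ hp =>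
    pow_ne_zero _ (Nat.prime_of_mem_primeFactors (Finset.mem_inter.1 hp).1).ne_zero

theorem wminus_eq_prod {w : ℕ} (hw : w ≠ 0) (m : ℕ) :
    wminus w m = ∏ p ∈ w.primeFactors \ m.primeFactors, p ^ w.factorization p := by
  have h : wplus w m * ∏ p ∈ w.primeFactors \ m.primeFactors, p ^ w.factorization p = w := by
    rw [wplus, Finset.prod_inter_mul_prod_sdiff]
    exact Nat.prod_factorization_pow_eq_self hw
  exact Nat.div_eq_of_eq_mul_right (Nat.pos_of_ne_zero (wplus_ne_zero w m)) h.symm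

theorem wplus_mul_wminus {w : ℕ} (hw : w ≠ 0) (m : ℕ) : wplus w m * wminus w m = w := by
  rw [wminus_eq_prod hw, wplus, Finset.prod_inter_mul_prod_sdiff]
  exact Nat.prod_factorization_pow_eq_self hw

theorem primeFactors_wplus_subset (w m : ℕ) : (wplus w m).primeFactors ⊆ m.primeFactors := by
  intro q hq
  have hqp := Nat.prime_of_mem_primeFactors hq
  obtain ⟨p, hp, hqdvd⟩ := (hqp.prime.dvd_finsetProd_iff _).1 (Nat.dvd_of_mem_primeFactors hq)
  rw [Finset.mem_inter] at hp
  rw [(Nat.prime_dvd_prime_iff_eq hqp (Nat.prime_of_mem_primeFactors hp.1)).1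
    (hqp.dvd_of_dvd_pow hqdvd)]
  exact hp.2

theorem coprime_wminus {w m : ℕ} (hw : w ≠ 0) (hm : m ≠ 0) : (wminus w m).Coprime m := by
  rw [wminus_eq_prod hw]
  refine Nat.Coprime.prod_left fun p hp => Nat.Coprime.pow_left _ ?_
  rw [Finset.mem_sdiff] at hp
  have hpp := Nat.prime_of_mem_primeFactors hp.1
  exact (Nat.Prime.coprime_iff_not_dvd hpp).2 fun hdvd =>
    hp.2 (Nat.mem_primeFactors.2 ⟨hpp, hdvd, hm⟩)

theorem totient_mul_eq_wplus_mul {w m : ℕ} (hw : w ≠ 0) (hm : m ≠ 0) :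
    (w * m).totient = wplus w m * (wminus w m).totient * m.totient := by
  have hsub := primeFactors_wplus_subset w m
  have hcop : (wminus w m).Coprime (wplus w m * m) := by
    have hc := coprime_wminus hw hm
    refine Nat.Coprime.mul_right ?_ hc
    refine (Nat.disjoint_primeFactors ?_ (wplus_ne_zero w m)).1
      ((hc.disjoint_primeFactors).mono_right hsub)
    intro h0
    exact hw (by rw [← wplus_mul_wminus hw m, h0, mul_zero])
  have h : w * m = wminus w m * (wplus w m * m) := by
    conv_lhs => rw [← wplus_mul_wminus hw m]
    ring
  rw [h, Nat.totient_mul hcop, Nat.totient_mul_of_primeFactors_subset hm hsub]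
  ring

theorem Int.four_mul_dvd_quadratic_iff_of_modEq {s k l a b : ℤ} (h : a ≡ b [ZMOD 2 * s]) :
    4 * s ∣ k * a ^ 2 + l ↔ 4 * s ∣ k * b ^ 2 + l := by
  obtain ⟨q, hq⟩ := h.dvd
  obtain rfl : b = a + 2 * s * q := by linarith
  have : k * (a + 2 * s * q) ^ 2 + l = (k * a ^ 2 + l) + 4 * s * (k * (a * q + s * q ^ 2)) := by
    ring
  rw [this]
  exact (dvd_add_left (dvd_mul_right _ _)).symm

/-- The units `v` modulo `2s` whose lifts satisfy `k v² + l ≡ 0 (mod 4s)` are in bijection with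
the idempotents of `ℤ/s`, through `z ↦ x (1 - 2z)` for any fixed solution `x`. -/
theorem card_units_quadratic {s : ℕ} [NeZero s] {k l x : ℤ} (hk : IsCoprime k (4 * s))
    (hx : IsCoprime x (4 * s)) (hsol : (4 * s : ℤ) ∣ k * x ^ 2 + l) :
    (Finset.univ.filter fun v : (ZMod (2 * s))ˣ =>
      (4 * s : ℤ) ∣ k * ((v : ZMod (2 * s)).val : ℤ) ^ 2 + l).card = 2 ^ s.primeFactors.card := by
  classical
  obtain ⟨y, m, hy⟩ := hx
  have hcast : ∀ a b : ℤ, ((a : ZMod (2 * s)) = b) ↔ a ≡ b [ZMOD 2 * s] := fun a b => by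
    simpa using ZMod.intCast_eq_intCast_iff a b (2 * s)
  have hidem : ∀ a : ℤ, IsIdempotentElem (a : ZMod s) ↔ (s : ℤ) ∣ a * a - a := fun a => by
    rw [IsIdempotentElem, ← Int.cast_mul, ZMod.intCast_eq_intCast_iff, Int.modEq_comm,
      Int.modEq_iff_dvd]
  have hsquare : ∀ a : ℤ, (s : ℤ) ∣ a * a - a → (4 * s : ℤ) ∣ (1 - 2 * a) ^ 2 - 1 := by
    rintro a ⟨q, hq⟩
    exact ⟨q, by linear_combination 4 * hq⟩
  have hunit : ∀ a : ℤ, (s : ℤ) ∣ a * a - a → IsUnit ((x * (1 - 2 * a) : ℤ) : ZMod (2 * s)) := by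
    intro a ha
    obtain ⟨q, hq⟩ := hsquare a ha
    refine IsUnit.of_mul_eq_one ((y * (1 - 2 * a) : ℤ) : ZMod (2 * s)) ?_
    rw [← Int.cast_mul, ← Int.cast_one (R := ZMod (2 * s)), hcast, Int.modEq_comm, Int.modEq_iff_dvd]
    refine ⟨2 * q * (x * y) - 2 * m, ?_⟩
    linear_combination x * y * hq + hy
  have hval : ∀ (v : ZMod (2 * s)) (a : ℤ), (a : ZMod (2 * s)) = v →
      a ≡ (v.val : ℤ) [ZMOD 2 * s] := fun v a h => by
    rw [← hcast, h]
    simp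
  rw [← ZMod.card_isIdempotentElem (NeZero.ne s), Nat.card_eq_fintype_card, eq_comm,
    ← Finset.card_univ]
  have hz : ∀ z : {z : ZMod s // IsIdempotentElem z},
      (s : ℤ) ∣ (z.1.val : ℤ) * z.1.val - z.1.val := fun z => by
    rw [← hidem]
    simpa using z.2
  refine Finset.card_bij (fun z _ => (hunit z.1.val (hz z)).unit) ?_ ?_ ?_
  · intro z _
    simp only [Finset.mem_filter, Finset.mem_univ, true_and]
    rw [← Int.four_mul_dvd_quadratic_iff_of_modEq (hval _ _ (IsUnit.unit_spec _).symm)]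
    obtain ⟨q, hq⟩ := hsquare _ (hz z)
    obtain ⟨r, hr⟩ := hsol
    exact ⟨k * x ^ 2 * q + r, by linear_combination k * x ^ 2 * hq + hr⟩
  · intro z _ z' _ h
    have h' := congrArg (Units.val) h
    simp only [IsUnit.unit_spec] at h'
    rw [hcast, Int.modEq_iff_dvd] at h'
    obtain ⟨q, hq⟩ := h'
    have hdvd : (s : ℤ) ∣ (z'.1.val : ℤ) - z.1.val := by
      refine ⟨- (q * y) + 4 * m * (z'.1.val - z.1.val), ?_⟩
      refine mul_left_cancel₀ (two_ne_zero (α := ℤ)) ?_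
      linear_combination -y * hq - 2 * (z'.1.val - z.1.val : ℤ) * hy
    rw [← Int.modEq_iff_dvd, ← ZMod.intCast_eq_intCast_iff] at hdvd
    exact Subtype.ext (by simpa using hdvd)
  · intro v hv
    simp only [Finset.mem_filter, Finset.mem_univ, true_and] at hv
    set c : ℤ := ((v : ZMod (2 * s)).val : ℤ) with hc
    have hcv : (c : ZMod (2 * s)) = v := by simp [hc]
    have hsq : (4 * s : ℤ) ∣ c ^ 2 - x ^ 2 := by
      refine hk.symm.dvd_of_dvd_mul_left ?_
      have := dvd_sub hv hsol
      rwa [show k * c ^ 2 + l - (k * x ^ 2 + l) = k * (c ^ 2 - x ^ 2) by ring] at this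
    have hone : (4 * s : ℤ) ∣ (y * c) ^ 2 - 1 := by
      obtain ⟨q, hq⟩ := hsq
      refine ⟨y ^ 2 * q - m * (1 + y * x), ?_⟩
      linear_combination y ^ 2 * hq + (1 + y * x) * hy
    have hodd : Odd (y * c) := by
      have h2 : (2 : ℤ) ∣ (y * c) ^ 2 - 1 := dvd_trans ⟨2 * s, by ring⟩ hone
      by_contra hev
      rw [Int.not_odd_iff_even] at hev
      obtain ⟨e, he⟩ := hev
      rw [he] at h2
      obtain ⟨f, hf⟩ := h2
      have : 2 * (2 * e * e - f) = 1 := by linear_combination hf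
      lia
    obtain ⟨e, he⟩ := hodd
    have hes : (s : ℤ) ∣ (-e) * (-e) - (-e) := by
      obtain ⟨q, hq⟩ := hone
      refine ⟨q, mul_left_cancel₀ (four_ne_zero (α := ℤ)) ?_⟩
      rw [he] at hq
      linear_combination hq
    refine ⟨⟨((-e : ℤ) : ZMod s), (hidem _).2 hes⟩, Finset.mem_univ _, ?_⟩
    ext
    rw [IsUnit.unit_spec, ← hcv, hcast, Int.modEq_iff_dvd]
    have hval' : (-e : ℤ) ≡ ((((-e : ℤ) : ZMod s).val : ℕ) : ℤ) [ZMOD s] := by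
      rw [← ZMod.intCast_eq_intCast_iff]
      simp
    obtain ⟨q, hq⟩ := hval'.dvd
    refine ⟨x * q + 2 * m * c, ?_⟩
    linear_combination 2 * x * hq - c * hy + x * he

/-- Natural numbers below `t` coprime to `t` correspond to units modulo `t`. -/
theorem card_range_coprime_filter (t : ℕ) [NeZero t] (P : ℕ → Prop) [DecidablePred P] :
    ((Finset.range t).filter fun c => Nat.gcd c t = 1 ∧ P c).card =
      (Finset.univ.filter fun u : (ZMod t)ˣ => P (u : ZMod t).val).card := by
  symm
  refine Finset.card_bij (fun u _ => (u : ZMod t).val) ?_ ?_ ?_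
  · intro u hu
    simp only [Finset.mem_filter, Finset.mem_univ, true_and, Finset.mem_range] at hu ⊢
    exact ⟨ZMod.val_lt _, ZMod.val_coe_unit_coprime u, hu⟩
  · intro u _ v _ h
    exact Units.ext (ZMod.val_injective t h)
  · intro c hc
    simp only [Finset.mem_filter, Finset.mem_range] at hc
    have hval : (ZMod.unitOfCoprime c hc.2.1 : ZMod t).val = c := by
      rw [ZMod.coe_unitOfCoprime, ZMod.val_natCast_of_lt hc.1]
    refine ⟨ZMod.unitOfCoprime c hc.2.1, ?_, hval⟩
    simp only [Finset.mem_filter, Finset.mem_univ, true_and, hval]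
    exact hc.2.2


/-- (see paper, Theorem on |Υ_n^{d,t}|)
`N(n,d,t)` is the number of residue classes `c` mod `t` with `gcd(c,t) = 1` and
`2t₁ ∣ g₁(d₁ + c²n₁)`. -/
theorem count_case_D_t_large
    (n d t g₀ d₁ n₁ g w g₁ t₁ : ℕ)
    (hn : 2 ≤ n) (hd : 1 ≤ d) (ht : 2 < t)
    (hg₀ : g₀ = Nat.gcd (2 * d) (2 * n + 2))
    (htdvd : t ∣ g₀)
    (hd₁ : d₁ = 2 * d / g₀) (hn₁ : n₁ = (2 * n + 2) / g₀)
    (hg : g = g₀ / t) (hw : w = Nat.gcd g t)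
    (hg₁ : g₁ = g / w) (ht₁ : t₁ = t / w)
    (hg₁odd : Odd g₁) (ht₁even : Even t₁)
    (hd₁t₁ : Nat.gcd d₁ t₁ = 1) (hn₁2t₁ : Nat.gcd n₁ (2 * t₁) = 1)
    (hQR : ∃ x : ℤ, (2 * (t₁ : ℤ)) ∣ ((n₁ : ℤ) * x ^ 2 + (d₁ : ℤ))) :
    ((Finset.range t).filter
        (fun c : ℕ => Nat.gcd c t = 1 ∧
          (2 * (t₁ : ℤ)) ∣ ((g₁ : ℤ) * ((d₁ : ℤ) + (c : ℤ) ^ 2 * (n₁ : ℤ))))).card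
      = wplus w t₁ * Nat.totient (wminus w t₁) * 2 ^ (t₁ / 2).primeFactors.card := by
  have hg₀pos : 0 < g₀ := hg₀ ▸ Nat.gcd_pos_of_pos_left _ (by lia)
  have htpos : 0 < t := by lia
  have hgpos : 0 < g := hg ▸ Nat.div_pos (Nat.le_of_dvd hg₀pos htdvd) htpos
  have hwpos : 0 < w := hw ▸ Nat.gcd_pos_of_pos_left _ hgpos
  have htw : t = w * t₁ := by
    rw [ht₁, Nat.mul_div_cancel' (hw ▸ Nat.gcd_dvd_right g t)]
  have hg₁t₁ : Nat.Coprime g₁ t₁ := by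
    rw [hg₁, ht₁, hw]
    exact Nat.coprime_div_gcd_div_gcd (hw ▸ hwpos)
  obtain ⟨s, hs⟩ := ht₁even.two_dvd
  have hs0 : s ≠ 0 := by
    rintro rfl
    simp [hs] at htw
    lia
  clear hg₀ htdvd hd₁ hn₁ hg hw hg₁ ht₁ hn hd
  subst hs
  have : NeZero s := ⟨hs0⟩
  have : NeZero t := ⟨htpos.ne'⟩
  obtain ⟨x, hx⟩ := hQR
  have hmod : (2 * ((2 * s : ℕ) : ℤ)) = 4 * s := by push_cast; ring
  rw [hmod] at hx ⊢
  have htwo : ∀ a : ℕ, Nat.Coprime a (2 * s) → IsCoprime (a : ℤ) (4 * s) := fun a ha => by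
    have h2 : Nat.Coprime a (2 * (2 * s)) := (ha.coprime_dvd_right (dvd_mul_right 2 s)).mul_right ha
    rw [← hmod]
    exact_mod_cast Nat.isCoprime_iff_coprime.2 h2
  have hn₁cop : IsCoprime (n₁ : ℤ) (4 * s) := htwo n₁ (Nat.Coprime.coprime_mul_left_right hn₁2t₁)
  have hxcop : IsCoprime x (4 * s) := by
    obtain ⟨a, b, hab⟩ := htwo d₁ hd₁t₁
    obtain ⟨q, hq⟩ := hx
    exact ⟨-(a * n₁ * x), b + a * q, by linear_combination hab - a * hq⟩
  have hg₁cop : IsCoprime (g₁ : ℤ) (4 * s) := htwo g₁ hg₁t₁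
  have hdvd : 2 * s ∣ t := ⟨w, by rw [htw, mul_comm]⟩
  rw [card_range_coprime_filter t fun c : ℕ =>
    (4 * s : ℤ) ∣ (g₁ : ℤ) * ((d₁ : ℤ) + (c : ℤ) ^ 2 * (n₁ : ℤ))]
  have hcount := ZMod.card_preimage_unitsMap hdvd (Finset.univ.filter fun v : (ZMod (2 * s))ˣ =>
      (4 * s : ℤ) ∣ n₁ * ((v : ZMod (2 * s)).val : ℤ) ^ 2 + d₁)
  rw [card_units_quadratic hn₁cop hxcop hx] at hcount
  have hfilter : ∀ u : (ZMod t)ˣ,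
      (4 * s : ℤ) ∣ (g₁ : ℤ) * ((d₁ : ℤ) + ((u : ZMod t).val : ℤ) ^ 2 * (n₁ : ℤ)) ↔
        ZMod.unitsMap hdvd u ∈ Finset.univ.filter fun v : (ZMod (2 * s))ˣ =>
          (4 * s : ℤ) ∣ n₁ * ((v : ZMod (2 * s)).val : ℤ) ^ 2 + d₁ := fun u => by
    simp only [Finset.mem_filter, Finset.mem_univ, true_and]
    have hred : ((u : ZMod t).val : ℤ) ≡
        ((ZMod.unitsMap hdvd u : ZMod (2 * s)).val : ℤ) [ZMOD 2 * s] := by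
      have := (ZMod.intCast_eq_intCast_iff ((u : ZMod t).val : ℤ)
        ((ZMod.unitsMap hdvd u : ZMod (2 * s)).val : ℤ) (2 * s)).1 (by
          simp [ZMod.unitsMap_val])
      exact_mod_cast this
    rw [← Int.four_mul_dvd_quadratic_iff_of_modEq hred, add_comm (d₁ : ℤ), mul_comm (n₁ : ℤ)]
    exact ⟨hg₁cop.symm.dvd_of_dvd_mul_left, fun h => h.mul_left _⟩
  simp only [← hfilter] at hcount
  rw [Nat.mul_div_cancel_left s two_pos]
  refine Nat.eq_of_mul_eq_mul_right (Nat.totient_pos.2 (by lia : 0 < 2 * s)) ?_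
  rw [hcount]
  conv_lhs => rw [htw]
  rw [totient_mul_eq_wplus_mul hwpos.ne' (by lia)]
  ring
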